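/- Let φ be a Schwartz function on ℝⁿ with ∫φ = 1, f ∈ BMO(ℝⁿ), and B = B(x₀, r). Then for all x, y ∈ B and all r ≤ ε' < ε, |[Φ_ε f(x) − Φ_{ε'} f(x)] − [Φ_ε f(y) − Φ_{ε'} f(y)]| ≤ ∫_r^∞ |∂/∂t[Φ_t(f − f_B)(x) − Φ_t(f − f_B)(y)]| dt ≤ C ‖f‖_{BMO}, with C depending only on n and φ. -/

import Mathlib

open MeasureTheory Metric

/-- Dilation `φ_t(x) = t^{-n} φ(x/t)` of a Schwartz function. -/
noncomputable def schwartzDil {n : ℕ} (φ : SchwartzMap (EuclideanSpace ℝ (Fin n)) ℝ)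
    (t : ℝ) (x : EuclideanSpace ℝ (Fin n)) : ℝ :=
  t ^ (-(n : ℤ)) * φ (t⁻¹ • x)

section Kernel

variable {E F : Type*} [NormedAddCommGroup E] [NormedSpace ℝ E]
  [NormedAddCommGroup F] [NormedSpace ℝ F]

theorem SchwartzMap.exists_norm_le_one_add_norm_rpow (η : SchwartzMap E F) (N : ℝ) :
    ∃ C, 0 ≤ C ∧ ∀ v, ‖η v‖ ≤ C * (1 + ‖v‖) ^ (-N) := by
  obtain ⟨k, hk⟩ := exists_nat_ge N
  refine ⟨2 ^ k * (Finset.Iic (k, 0)).sup (fun m => SchwartzMap.seminorm ℝ m.1 m.2) η,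
    by positivity, fun v => ?_⟩
  have h := SchwartzMap.one_add_le_sup_seminorm_apply (𝕜 := ℝ) (m := (k, 0)) le_rfl le_rfl η v
  rw [norm_iteratedFDeriv_zero] at h
  have hv : 1 ≤ 1 + ‖v‖ := by simp
  have hpos : 0 < (1 + ‖v‖) ^ N := by positivity
  rw [Real.rpow_neg (by positivity), ← div_eq_mul_inv, le_div_iff₀ hpos, mul_comm]
  refine le_trans ?_ h
  gcongr
  rw [← Real.rpow_natCast]
  exact Real.rpow_le_rpow_of_exponent_le hv hk

theorem one_add_norm_smul_sub_rpow_le {x₀ p z : E} {r s N : ℝ} (hr : 0 < r) (hN : 0 ≤ N)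
    (hp : p ∈ ball x₀ r) (hs : r / 2 < s) :
    (1 + ‖s⁻¹ • (p - z)‖) ^ (-N) ≤ (4 * s / r) ^ N * (1 + ‖z - x₀‖ / r) ^ (-N) := by
  have hs0 : 0 < s := by linarith
  have h0 : 0 ≤ ‖z - x₀‖ / r := by positivity
  have key : (4 * s / r)⁻¹ * (1 + ‖z - x₀‖ / r) ≤ 1 + ‖s⁻¹ • (p - z)‖ := by
    have h1 : ‖z - x₀‖ ≤ ‖p - z‖ + r := by
      have h2 : ‖p - x₀‖ < r := by simpa [dist_eq_norm] using hp
      have h3 : z - x₀ = (p - x₀) - (p - z) := by abel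
      rw [h3]
      linarith [norm_sub_le (p - x₀) (p - z)]
    rw [norm_smul, norm_inv, Real.norm_of_nonneg hs0.le]
    have h4 : (4 * s / r)⁻¹ * (1 + ‖z - x₀‖ / r) = (r + ‖z - x₀‖) / (4 * s) := by
      field_simp
    have h5 : 1 + s⁻¹ * ‖p - z‖ = (4 * s + 4 * ‖p - z‖) / (4 * s) := by
      field_simp
    rw [h4, h5]
    refine div_le_div_of_nonneg_right ?_ (by positivity)
    linarith [norm_nonneg (p - z)]
  calc (1 + ‖s⁻¹ • (p - z)‖) ^ (-N)
      ≤ ((4 * s / r)⁻¹ * (1 + ‖z - x₀‖ / r)) ^ (-N) :=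
        Real.rpow_le_rpow_of_nonpos (by positivity) key (by linarith)
    _ = (4 * s / r) ^ N * (1 + ‖z - x₀‖ / r) ^ (-N) := by
        rw [Real.mul_rpow (by positivity) (by positivity), Real.inv_rpow (by positivity),
          Real.rpow_neg (by positivity), inv_inv]

theorem SchwartzMap.exists_norm_dilation_le (η : SchwartzMap E F) {N : ℝ} (hN : 0 ≤ N) :
    ∃ C, 0 ≤ C ∧ ∀ (x₀ : E) (r : ℝ), 0 < r → ∀ x ∈ ball x₀ r, ∀ s, r / 2 < s → ∀ z,
      ‖η (s⁻¹ • (x - z))‖ ≤ C * ((4 * s / r) ^ N * (1 + ‖z - x₀‖ / r) ^ (-N)) := by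
  obtain ⟨C, hC, h⟩ := η.exists_norm_le_one_add_norm_rpow N
  refine ⟨C, hC, fun x₀ r hr x hx s hs z => (h _).trans ?_⟩
  gcongr
  exact one_add_norm_smul_sub_rpow_le hr hN hx hs

theorem SchwartzMap.exists_norm_dilation_sub_le (η : SchwartzMap E F) {N : ℝ} (hN : 0 ≤ N) :
    ∃ C, 0 ≤ C ∧ ∀ (x₀ : E) (r : ℝ), 0 < r → ∀ x ∈ ball x₀ r, ∀ y ∈ ball x₀ r,
      ∀ s, r / 2 < s → ∀ z, ‖η (s⁻¹ • (x - z)) - η (s⁻¹ • (y - z))‖ ≤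
        C * (r / s) * ((4 * s / r) ^ N * (1 + ‖z - x₀‖ / r) ^ (-N)) := by
  obtain ⟨C, hC, h⟩ := (fderivCLM ℝ E F η).exists_norm_dilation_le hN
  refine ⟨2 * C, by positivity, fun x₀ r hr x hx y hy s hs z => ?_⟩
  have hs0 : 0 < s := by linarith
  have hd : ∀ p : E, HasFDerivAt (fun p => η (s⁻¹ • (p - z)))
      (s⁻¹ • fderiv ℝ η (s⁻¹ • (p - z))) p := fun p => by
    have h1 : HasFDerivAt (fun p : E => s⁻¹ • (p - z)) (s⁻¹ • ContinuousLinearMap.id ℝ E) p :=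
      ((hasFDerivAt_id p).sub_const z).const_smul s⁻¹
    refine ((η.hasFDerivAt (s⁻¹ • (p - z))).comp p h1).congr_fderiv ?_
    ext v
    simp
  have hb : ∀ p ∈ ball x₀ r, ‖s⁻¹ • fderiv ℝ η (s⁻¹ • (p - z))‖ ≤
      s⁻¹ * (C * ((4 * s / r) ^ N * (1 + ‖z - x₀‖ / r) ^ (-N))) := fun p hp => by
    rw [norm_smul, norm_inv, Real.norm_of_nonneg hs0.le]
    gcongr
    exact h x₀ r hr p hp s hs z
  refine ((convex_ball x₀ r).norm_image_sub_le_of_norm_hasFDerivWithin_le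
    (fun p _ => (hd p).hasFDerivWithinAt) hb hy hx).trans ?_
  have hxy : ‖x - y‖ ≤ 2 * r := by
    rw [← dist_eq_norm]
    rw [mem_ball] at hx hy
    linarith [dist_triangle_right x y x₀]
  calc _ ≤ s⁻¹ * (C * ((4 * s / r) ^ N * (1 + ‖z - x₀‖ / r) ^ (-N))) * (2 * r) := by
        gcongr
    _ = _ := by ring

end Kernel

section Dilation

variable {n : ℕ}

/-- The Schwartz function `η` with `∂ₜ φₜ(x) = t⁻ⁿ⁻¹ η(x / t)`. -/
noncomputable def schwartzDilDeriv (φ : SchwartzMap (EuclideanSpace ℝ (Fin n)) ℝ) :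
    SchwartzMap (EuclideanSpace ℝ (Fin n)) ℝ :=
  -((n : ℝ) • φ) - SchwartzMap.bilinLeftCLM
    (ContinuousLinearMap.id ℝ (EuclideanSpace ℝ (Fin n) →L[ℝ] ℝ))
    (Function.HasTemperateGrowth.id (E := EuclideanSpace ℝ (Fin n)))
    (SchwartzMap.fderivCLM ℝ (EuclideanSpace ℝ (Fin n)) ℝ φ)

theorem schwartzDilDeriv_apply (φ : SchwartzMap (EuclideanSpace ℝ (Fin n)) ℝ)
    (v : EuclideanSpace ℝ (Fin n)) :
    schwartzDilDeriv φ v = -(n * φ v) - fderiv ℝ φ v v := by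
  simp [schwartzDilDeriv, SchwartzMap.bilinLeftCLM_apply]

theorem hasDerivAt_schwartzDil (φ : SchwartzMap (EuclideanSpace ℝ (Fin n)) ℝ)
    {t : ℝ} (ht : 0 < t) (x : EuclideanSpace ℝ (Fin n)) :
    HasDerivAt (fun s => schwartzDil φ s x)
      (t ^ (-(n : ℤ) - 1) * schwartzDilDeriv φ (t⁻¹ • x)) t := by
  have h1 : HasDerivAt (fun s : ℝ => s⁻¹ • x) ((-(t ^ 2)⁻¹) • x) t :=
    (hasDerivAt_inv ht.ne').smul_const x
  have h2 := (φ.hasFDerivAt (t⁻¹ • x)).comp_hasDerivAt t h1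
  have h3 := (hasDerivAt_zpow (-(n : ℤ)) t (Or.inl ht.ne')).mul h2
  refine h3.congr_deriv ?_
  rw [schwartzDilDeriv_apply, ContinuousLinearMap.map_smul, ContinuousLinearMap.map_smul,
    zpow_sub_one₀ ht.ne']
  simp only [Function.comp, smul_eq_mul]
  push_cast
  field_simp
  ring

theorem continuous_schwartzDil (φ : SchwartzMap (EuclideanSpace ℝ (Fin n)) ℝ) (t : ℝ) :
    Continuous (schwartzDil φ t) :=
  continuous_const.mul (φ.continuous.comp (continuous_const_smul _))

theorem integrable_schwartzDil (φ : SchwartzMap (EuclideanSpace ℝ (Fin n)) ℝ) {t : ℝ} (ht : t ≠ 0) :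
    Integrable (schwartzDil φ t) :=
  ((integrable_comp_smul_iff volume φ (inv_ne_zero ht)).2 φ.integrable).const_mul _

end Dilation

section MeanOscillation

variable {n : ℕ}

theorem volume_real_ball_eq (c : EuclideanSpace ℝ (Fin n)) {ρ : ℝ} (hρ : 0 < ρ) :
    volume.real (ball c ρ) = ρ ^ n * volume.real (ball (0 : EuclideanSpace ℝ (Fin n)) 1) := by
  rw [measureReal_def, Measure.addHaar_ball_of_pos volume c hρ, ENNReal.toReal_mul,
    ENNReal.toReal_ofReal (by positivity), measureReal_def, finrank_euclideanSpace,
    Fintype.card_fin]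

theorem volume_real_ball_pos (c : EuclideanSpace ℝ (Fin n)) {ρ : ℝ} (hρ : 0 < ρ) :
    0 < volume.real (ball c ρ) :=
  ENNReal.toReal_pos (measure_ball_pos volume c hρ).ne' measure_ball_lt_top.ne

theorem MeasureTheory.LocallyIntegrable.integrableOn_ball {f : EuclideanSpace ℝ (Fin n) → ℝ}
    (hf : LocallyIntegrable f volume) (c : EuclideanSpace ℝ (Fin n)) (ρ : ℝ) :
    IntegrableOn f (ball c ρ) volume :=
  (hf.integrableOn_isCompact (isCompact_closedBall c ρ)).mono_set ball_subset_closedBall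

theorem MeasureTheory.LocallyIntegrable.sub_const {f : EuclideanSpace ℝ (Fin n) → ℝ}
    (hf : LocallyIntegrable f volume) (a : ℝ) : LocallyIntegrable (fun z => f z - a) volume :=
  hf.sub (locallyIntegrable_const a)

variable {f : EuclideanSpace ℝ (Fin n) → ℝ} {M : ℝ}

theorem setIntegral_abs_sub_average_le
    (hM : ∀ (c : EuclideanSpace ℝ (Fin n)) (ρ : ℝ), 0 < ρ →
      ⨍ y in ball c ρ, |f y - ⨍ z in ball c ρ, f z| ≤ M)
    (c : EuclideanSpace ℝ (Fin n)) {ρ : ℝ} (hρ : 0 < ρ) :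
    ∫ y in ball c ρ, |f y - ⨍ z in ball c ρ, f z| ≤ M * volume.real (ball c ρ) := by
  have h := hM c ρ hρ
  rw [setAverage_eq, smul_eq_mul, inv_mul_le_iff₀ (volume_real_ball_pos c hρ)] at h
  linarith

theorem abs_average_ball_sub_average_ball_two_mul_le (hf : LocallyIntegrable f volume)
    (hM : ∀ (c : EuclideanSpace ℝ (Fin n)) (ρ : ℝ), 0 < ρ →
      ⨍ y in ball c ρ, |f y - ⨍ z in ball c ρ, f z| ≤ M)
    (c : EuclideanSpace ℝ (Fin n)) {ρ : ℝ} (hρ : 0 < ρ) :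
    |(⨍ z in ball c ρ, f z) - ⨍ z in ball c (2 * ρ), f z| ≤ 2 ^ n * M := by
  set m := ⨍ z in ball c (2 * ρ), f z
  have hV := volume_real_ball_pos c hρ
  have h1 : ((⨍ z in ball c ρ, f z) - m) * volume.real (ball c ρ) =
      ∫ z in ball c ρ, (f z - m) := by
    rw [integral_sub (hf.integrableOn_ball c ρ)
      (integrableOn_const measure_ball_lt_top.ne), setIntegral_const, setAverage_eq,
      smul_eq_mul, smul_eq_mul]
    field_simp
  have h2 : |∫ z in ball c ρ, (f z - m)| ≤ M * volume.real (ball c (2 * ρ)) :=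
    calc |∫ z in ball c ρ, (f z - m)| ≤ ∫ z in ball c ρ, |f z - m| := abs_integral_le_integral_abs
      _ ≤ ∫ z in ball c (2 * ρ), |f z - m| :=
        setIntegral_mono_set ((hf.sub_const m).integrableOn_ball c (2 * ρ)).abs
          (Filter.Eventually.of_forall fun _ => abs_nonneg _)
          (ball_subset_ball (by linarith)).eventuallyLE
      _ ≤ _ := setIntegral_abs_sub_average_le hM c (by positivity)
  rw [← h1, abs_mul, abs_of_pos hV, volume_real_ball_eq c (by positivity : 0 < 2 * ρ), mul_pow,
    mul_assoc, ← volume_real_ball_eq c hρ, ← mul_assoc] at h2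
  linarith [le_of_mul_le_mul_right h2 hV]

theorem abs_average_ball_sub_average_ball_two_pow_mul_le (hf : LocallyIntegrable f volume)
    (hM : ∀ (c : EuclideanSpace ℝ (Fin n)) (ρ : ℝ), 0 < ρ →
      ⨍ y in ball c ρ, |f y - ⨍ z in ball c ρ, f z| ≤ M)
    (c : EuclideanSpace ℝ (Fin n)) {r : ℝ} (hr : 0 < r) (k : ℕ) :
    |(⨍ z in ball c r, f z) - ⨍ z in ball c (2 ^ k * r), f z| ≤ k * (2 ^ n * M) := by
  induction k with
  | zero => simp
  | succ k ih =>
    have h := abs_average_ball_sub_average_ball_two_mul_le hf hM c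
      (by positivity : 0 < 2 ^ k * r)
    rw [← mul_assoc, ← pow_succ'] at h
    have h3 := abs_sub_le (⨍ z in ball c r, f z) (⨍ z in ball c (2 ^ k * r), f z)
      (⨍ z in ball c (2 ^ (k + 1) * r), f z)
    push_cast
    linarith

theorem setIntegral_ball_two_pow_abs_sub_average_le (hf : LocallyIntegrable f volume)
    (hM : ∀ (c : EuclideanSpace ℝ (Fin n)) (ρ : ℝ), 0 < ρ →
      ⨍ y in ball c ρ, |f y - ⨍ z in ball c ρ, f z| ≤ M)
    (c : EuclideanSpace ℝ (Fin n)) {r : ℝ} (hr : 0 < r) (k : ℕ) :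
    ∫ z in ball c (2 ^ k * r), |f z - ⨍ u in ball c r, f u| ≤
      (1 + k * 2 ^ n) * M *
        ((2 ^ k * r) ^ n * volume.real (ball (0 : EuclideanSpace ℝ (Fin n)) 1)) := by
  have hρ : 0 < 2 ^ k * r := by positivity
  rw [← volume_real_ball_eq c hρ]
  set m := ⨍ u in ball c r, f u
  set m' := ⨍ u in ball c (2 ^ k * r), f u
  have h1 : |m - m'| ≤ k * (2 ^ n * M) :=
    abs_average_ball_sub_average_ball_two_pow_mul_le hf hM c hr k
  have hi : IntegrableOn (fun z => |f z - m'|) (ball c (2 ^ k * r)) volume :=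
    ((hf.sub_const m').integrableOn_ball c _).abs
  calc ∫ z in ball c (2 ^ k * r), |f z - m|
      ≤ ∫ z in ball c (2 ^ k * r), (|f z - m'| + |m - m'|) := by
        refine integral_mono ((hf.sub_const m).integrableOn_ball c _).abs
          (hi.add (integrableOn_const measure_ball_lt_top.ne)) fun z => ?_
        rw [abs_sub_comm m m']
        exact abs_sub_le (f z) m' m
    _ = (∫ z in ball c (2 ^ k * r), |f z - m'|) +
          |m - m'| * volume.real (ball c (2 ^ k * r)) := by
        rw [integral_add hi (integrableOn_const measure_ball_lt_top.ne), setIntegral_const,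
          smul_eq_mul, mul_comm |m - m'|]
    _ ≤ M * volume.real (ball c (2 ^ k * r)) +
          k * (2 ^ n * M) * volume.real (ball c (2 ^ k * r)) := by
        gcongr
        exact setIntegral_abs_sub_average_le hM c hρ
    _ = _ := by ring

theorem exists_mem_ball_rpow_neg_le {E : Type*} [NormedAddCommGroup E] (c z : E) {r N : ℝ}
    (hr : 0 < r) (hN : 0 ≤ N) :
    ∃ k : ℕ, z ∈ ball c (2 ^ k * r) ∧ (1 + ‖z - c‖ / r) ^ (-N) ≤ 2 ^ N * (2 ^ (-N)) ^ k := by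
  have h0 : 0 ≤ ‖z - c‖ / r := by positivity
  obtain ⟨m, h1, h2⟩ := exists_nat_pow_near (x := 1 + ‖z - c‖ / r) (y := 2)
    (by linarith) one_lt_two
  refine ⟨m + 1, ?_, ?_⟩
  · rw [mem_ball, dist_eq_norm, ← div_lt_iff₀ hr]
    linarith
  · calc (1 + ‖z - c‖ / r) ^ (-N) ≤ ((2 : ℝ) ^ m) ^ (-N) :=
          Real.rpow_le_rpow_of_nonpos (by positivity) h1 (by linarith)
      _ = ((2 : ℝ) ^ (-N)) ^ m := by
          rw [← Real.rpow_natCast, ← Real.rpow_natCast, ← Real.rpow_mul zero_le_two,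
            ← Real.rpow_mul zero_le_two, mul_comm]
      _ = 2 ^ N * (2 ^ (-N)) ^ (m + 1) := by
          rw [pow_succ', ← mul_assoc, ← Real.rpow_add zero_lt_two, add_neg_cancel,
            Real.rpow_zero, one_mul]

theorem two_rpow_neg_add_half_pow_mul (n k : ℕ) :
    ((2 : ℝ) ^ (-(n + 1 / 2 : ℝ))) ^ k * (2 ^ k) ^ n = ((2 : ℝ) ^ (-(1 / 2) : ℝ)) ^ k := by
  rw [← pow_mul, mul_comm k n, pow_mul, ← mul_pow]
  congr 1
  rw [← Real.rpow_natCast, ← Real.rpow_add zero_lt_two]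
  congr 1
  ring

theorem summable_dyadic (n : ℕ) :
    Summable fun k : ℕ => (1 + k * 2 ^ n : ℝ) * ((2 : ℝ) ^ (-(1 / 2) : ℝ)) ^ k := by
  have hq : ‖(2 : ℝ) ^ (-(1 / 2) : ℝ)‖ < 1 := by
    rw [Real.norm_of_nonneg (by positivity)]
    exact Real.rpow_lt_one_of_one_lt_of_neg one_lt_two (by norm_num)
  have h1 := summable_geometric_of_norm_lt_one hq
  have h2 := (summable_pow_mul_geometric_of_norm_lt_one 1 hq).mul_right (2 ^ n)
  refine (h1.add h2).congr fun k => ?_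
  ring

/-- The weighted `L¹` bound for functions of bounded mean oscillation. -/
theorem exists_integral_abs_sub_average_mul_weight_le (n : ℕ) :
    ∃ K, 0 ≤ K ∧ ∀ (f : EuclideanSpace ℝ (Fin n) → ℝ) (M : ℝ), LocallyIntegrable f volume →
      (∀ (c : EuclideanSpace ℝ (Fin n)) (ρ : ℝ), 0 < ρ →
        ⨍ y in ball c ρ, |f y - ⨍ z in ball c ρ, f z| ≤ M) →
      ∀ (c : EuclideanSpace ℝ (Fin n)) (r : ℝ), 0 < r →
        Integrable (fun z => |f z - ⨍ u in ball c r, f u| *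
          (1 + ‖z - c‖ / r) ^ (-(n + 1 / 2 : ℝ))) ∧
        ∫ z, |f z - ⨍ u in ball c r, f u| * (1 + ‖z - c‖ / r) ^ (-(n + 1 / 2 : ℝ)) ≤
          K * M * r ^ n := by
  set N : ℝ := n + 1 / 2 with hN
  have hN0 : 0 ≤ N := by positivity
  set V := volume.real (ball (0 : EuclideanSpace ℝ (Fin n)) 1)
  set a : ℕ → ℝ := fun k => (1 + k * 2 ^ n : ℝ) * ((2 : ℝ) ^ (-(1 / 2) : ℝ)) ^ k
  have ha0 : ∀ k, 0 ≤ a k := fun k => by positivity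
  have hV0 : 0 ≤ V := measureReal_nonneg
  have hS0 : 0 ≤ ∑' k, a k := tsum_nonneg ha0
  refine ⟨2 ^ N * V * ∑' k, a k, mul_nonneg (by positivity) hS0, fun f M hf hM c r hr => ?_⟩
  set g : EuclideanSpace ℝ (Fin n) → ℝ := fun z => f z - ⨍ u in ball c r, f u
  have hg : LocallyIntegrable g volume := hf.sub_const _
  have hM0 : 0 ≤ M := by
    refine le_trans ?_ (hM c r hr)
    rw [setAverage_eq]
    positivity
  have hgi : ∀ k : ℕ, IntegrableOn (fun z => 2 ^ N * (2 ^ (-N)) ^ k * |g z|)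
      (ball c (2 ^ k * r)) := fun k => (hg.integrableOn_ball c _).abs.const_mul _
  have hk : ∀ k : ℕ, ∫⁻ z, (ball c (2 ^ k * r)).indicator
      (fun z => ENNReal.ofReal (2 ^ N * (2 ^ (-N)) ^ k * |g z|)) z ≤
        ENNReal.ofReal (2 ^ N * V * M * r ^ n * a k) := fun k => by
    rw [lintegral_indicator measurableSet_ball, ← ofReal_integral_eq_lintegral_ofReal (hgi k)
      (Filter.Eventually.of_forall fun z => by positivity), integral_const_mul]
    refine ENNReal.ofReal_le_ofReal ?_
    calc _ ≤ 2 ^ N * (2 ^ (-N)) ^ k * ((1 + k * 2 ^ n) * M * ((2 ^ k * r) ^ n * V)) := by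
          gcongr
          exact setIntegral_ball_two_pow_abs_sub_average_le hf hM c hr k
      _ = 2 ^ N * V * M * r ^ n * ((1 + k * 2 ^ n) * ((2 ^ (-N)) ^ k * (2 ^ k) ^ n)) := by
          rw [mul_pow]; ring
      _ = _ := by rw [hN, two_rpow_neg_add_half_pow_mul]
  have hpt : ∀ z, ENNReal.ofReal (|g z| * (1 + ‖z - c‖ / r) ^ (-N)) ≤
      ∑' k : ℕ, (ball c (2 ^ k * r)).indicator
        (fun z => ENNReal.ofReal (2 ^ N * (2 ^ (-N)) ^ k * |g z|)) z := fun z => by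
    obtain ⟨k, hz, hw⟩ := exists_mem_ball_rpow_neg_le c z hr hN0
    refine le_trans ?_ (ENNReal.le_tsum k)
    rw [Set.indicator_of_mem hz]
    refine ENNReal.ofReal_le_ofReal ?_
    rw [mul_comm]
    gcongr
  have hsum : Summable fun k => 2 ^ N * V * M * r ^ n * a k := (summable_dyadic n).mul_left _
  have hlin : ∫⁻ z, ENNReal.ofReal (|g z| * (1 + ‖z - c‖ / r) ^ (-N)) ≤
      ENNReal.ofReal (2 ^ N * V * (∑' k, a k) * M * r ^ n) :=
    calc _ ≤ ∫⁻ z, ∑' k : ℕ, (ball c (2 ^ k * r)).indicator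
            (fun z => ENNReal.ofReal (2 ^ N * (2 ^ (-N)) ^ k * |g z|)) z := lintegral_mono hpt
      _ = ∑' k : ℕ, ∫⁻ z, (ball c (2 ^ k * r)).indicator
            (fun z => ENNReal.ofReal (2 ^ N * (2 ^ (-N)) ^ k * |g z|)) z :=
          lintegral_tsum fun k => ((hg.aestronglyMeasurable.aemeasurable.abs.const_mul
            _).ennreal_ofReal).indicator measurableSet_ball
      _ ≤ ∑' k, ENNReal.ofReal (2 ^ N * V * M * r ^ n * a k) := ENNReal.tsum_le_tsum hk
      _ = ENNReal.ofReal (∑' k, 2 ^ N * V * M * r ^ n * a k) :=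
          (ENNReal.ofReal_tsum_of_nonneg (fun k => by have := ha0 k; positivity) hsum).symm
      _ = _ := by rw [tsum_mul_left]; congr 1; ring
  have hmeas : AEStronglyMeasurable (fun z => |g z| * (1 + ‖z - c‖ / r) ^ (-N)) volume := by
    refine hg.aestronglyMeasurable.norm.mul (Measurable.aestronglyMeasurable ?_)
    fun_prop
  have hnn : 0 ≤ᵐ[volume] fun z => |g z| * (1 + ‖z - c‖ / r) ^ (-N) :=
    Filter.Eventually.of_forall fun z => by positivity
  refine ⟨⟨hmeas, ?_⟩, ?_⟩
  · rw [hasFiniteIntegral_iff_ofReal hnn]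
    exact hlin.trans_lt ENNReal.ofReal_lt_top
  · rw [integral_eq_lintegral_of_nonneg_ae hnn hmeas]
    refine ENNReal.toReal_le_of_le_ofReal ?_ hlin
    positivity

end MeanOscillation

section Main

variable {n : ℕ}

theorem zpow_mul_div_mul_rpow_eq (n : ℕ) {r s : ℝ} (hr : 0 < r) (hs : 0 < s) :
    s ^ (-(n : ℤ) - 1) * ((r / s) * (4 * s / r) ^ (n + 1 / 2 : ℝ)) =
      4 ^ (n + 1 / 2 : ℝ) * (r ^ (1 / 2 - n : ℝ) * s ^ (-(3 / 2) : ℝ)) := by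
  have h1 : s ^ (-(n : ℤ) - 1) = s ^ (-n - 1 : ℝ) := by
    rw [← Real.rpow_intCast]; push_cast; rfl
  have h2 : r / s = r ^ (1 : ℝ) * s ^ (-1 : ℝ) := by
    rw [Real.rpow_one, Real.rpow_neg_one, div_eq_mul_inv]
  have h3 : (4 * s / r) ^ (n + 1 / 2 : ℝ) =
      4 ^ (n + 1 / 2 : ℝ) * s ^ (n + 1 / 2 : ℝ) * r ^ (-(n + 1 / 2) : ℝ) := by
    rw [Real.div_rpow (by positivity) hr.le, Real.mul_rpow (by positivity) hs.le,
      Real.rpow_neg hr.le, div_eq_mul_inv]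
  have h4 : r ^ (1 / 2 - n : ℝ) = r ^ (1 : ℝ) * r ^ (-(n + 1 / 2) : ℝ) := by
    rw [← Real.rpow_add hr]; congr 1; ring
  have h5 : s ^ (-(3 / 2) : ℝ) = s ^ (-n - 1 : ℝ) * s ^ (-1 : ℝ) * s ^ (n + 1 / 2 : ℝ) := by
    rw [← Real.rpow_add hs, ← Real.rpow_add hs]; congr 1; ring
  rw [h1, h2, h3, h4, h5]
  ring

/-- The `t`-derivative of `z ↦ φₜ(x - z) - φₜ(y - z)`. -/
noncomputable def schwartzDilSubDeriv (φ : SchwartzMap (EuclideanSpace ℝ (Fin n)) ℝ)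
    (x y : EuclideanSpace ℝ (Fin n)) (t : ℝ) (z : EuclideanSpace ℝ (Fin n)) : ℝ :=
  t ^ (-(n : ℤ) - 1) *
    (schwartzDilDeriv φ (t⁻¹ • (x - z)) - schwartzDilDeriv φ (t⁻¹ • (y - z)))

theorem continuous_schwartzDilSubDeriv (φ : SchwartzMap (EuclideanSpace ℝ (Fin n)) ℝ)
    (x y : EuclideanSpace ℝ (Fin n)) (t : ℝ) :
    Continuous (schwartzDilSubDeriv φ x y t) := by
  have := (schwartzDilDeriv φ).continuous
  unfold schwartzDilSubDeriv
  fun_prop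

theorem exists_abs_schwartzDilSubDeriv_le (φ : SchwartzMap (EuclideanSpace ℝ (Fin n)) ℝ) :
    ∃ A, 0 ≤ A ∧ ∀ (x₀ : EuclideanSpace ℝ (Fin n)) (r : ℝ), 0 < r → ∀ x ∈ ball x₀ r,
      ∀ y ∈ ball x₀ r, ∀ s, r / 2 < s → ∀ z, |schwartzDilSubDeriv φ x y s z| ≤
        A * (r ^ (1 / 2 - n : ℝ) * s ^ (-(3 / 2) : ℝ)) *
          (1 + ‖z - x₀‖ / r) ^ (-(n + 1 / 2 : ℝ)) := by
  obtain ⟨C, hC, h⟩ := (schwartzDilDeriv φ).exists_norm_dilation_sub_le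
    (by positivity : 0 ≤ (n + 1 / 2 : ℝ))
  refine ⟨C * 4 ^ (n + 1 / 2 : ℝ), by positivity, fun x₀ r hr x hx y hy s hs z => ?_⟩
  have hs0 : 0 < s := by linarith
  have h1 := h x₀ r hr x hx y hy s hs z
  rw [Real.norm_eq_abs] at h1
  rw [schwartzDilSubDeriv, abs_mul, abs_of_pos (by positivity : 0 < s ^ (-(n : ℤ) - 1))]
  calc _ ≤ s ^ (-(n : ℤ) - 1) * (C * (r / s) * ((4 * s / r) ^ (n + 1 / 2 : ℝ) *
          (1 + ‖z - x₀‖ / r) ^ (-(n + 1 / 2 : ℝ)))) := by gcongr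
    _ = C * (s ^ (-(n : ℤ) - 1) * ((r / s) * (4 * s / r) ^ (n + 1 / 2 : ℝ))) *
          (1 + ‖z - x₀‖ / r) ^ (-(n + 1 / 2 : ℝ)) := by ring
    _ = _ := by rw [zpow_mul_div_mul_rpow_eq n hr hs0]; ring

theorem integrable_schwartzDil_sub_mul (φ : SchwartzMap (EuclideanSpace ℝ (Fin n)) ℝ)
    {g : EuclideanSpace ℝ (Fin n) → ℝ} {x₀ x : EuclideanSpace ℝ (Fin n)} {r s : ℝ}
    (hg : AEStronglyMeasurable g volume)
    (hgi : Integrable (fun z => |g z| * (1 + ‖z - x₀‖ / r) ^ (-(n + 1 / 2 : ℝ))))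
    (hr : 0 < r) (hx : x ∈ ball x₀ r) (hs : r / 2 < s) :
    Integrable (fun z => schwartzDil φ s (x - z) * g z) := by
  obtain ⟨C, -, h⟩ := φ.exists_norm_dilation_le (by positivity : 0 ≤ (n + 1 / 2 : ℝ))
  refine (hgi.const_mul (|s ^ (-(n : ℤ))| * (C * (4 * s / r) ^ (n + 1 / 2 : ℝ)))).mono'
    (((continuous_schwartzDil φ s).comp
      (continuous_const.sub continuous_id)).aestronglyMeasurable.mul hg)
    (Filter.Eventually.of_forall fun z => ?_)
  have h1 := h x₀ r hr x hx s hs z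
  rw [Real.norm_eq_abs] at h1
  rw [Real.norm_eq_abs, abs_mul, schwartzDil, abs_mul]
  calc _ ≤ |s ^ (-(n : ℤ))| * (C * ((4 * s / r) ^ (n + 1 / 2 : ℝ) *
        (1 + ‖z - x₀‖ / r) ^ (-(n + 1 / 2 : ℝ)))) * |g z| := by gcongr
    _ = _ := by ring

theorem hasDerivAt_integral_schwartzDil_sub_mul
    (φ : SchwartzMap (EuclideanSpace ℝ (Fin n)) ℝ)
    {g : EuclideanSpace ℝ (Fin n) → ℝ} {x₀ x y : EuclideanSpace ℝ (Fin n)} {r t : ℝ}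
    (hg : AEStronglyMeasurable g volume)
    (hgi : Integrable (fun z => |g z| * (1 + ‖z - x₀‖ / r) ^ (-(n + 1 / 2 : ℝ))))
    (hr : 0 < r) (hx : x ∈ ball x₀ r) (hy : y ∈ ball x₀ r) (ht : r / 2 < t) :
    HasDerivAt (fun s => ∫ z, (schwartzDil φ s (x - z) - schwartzDil φ s (y - z)) * g z)
      (∫ z, schwartzDilSubDeriv φ x y t z * g z) t := by
  obtain ⟨A, hA, h⟩ := exists_abs_schwartzDilSubDeriv_le φ
  have hint : ∀ s, r / 2 < s →
      Integrable fun z => (schwartzDil φ s (x - z) - schwartzDil φ s (y - z)) * g z :=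
    fun s hs => by
      simp only [sub_mul]
      exact (integrable_schwartzDil_sub_mul φ hg hgi hr hx hs).sub
        (integrable_schwartzDil_sub_mul φ hg hgi hr hy hs)
  refine (hasDerivAt_integral_of_dominated_loc_of_deriv_le (Ioi_mem_nhds ht)
    (bound := fun z => A * (r ^ (1 / 2 - n : ℝ) * (r / 2) ^ (-(3 / 2) : ℝ)) *
      (|g z| * (1 + ‖z - x₀‖ / r) ^ (-(n + 1 / 2 : ℝ))))
    (F' := fun s z => schwartzDilSubDeriv φ x y s z * g z)
    (Filter.eventually_of_mem (Ioi_mem_nhds ht) fun s hs => (hint s hs).aestronglyMeasurable)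
    (hint t ht) ((continuous_schwartzDilSubDeriv φ x y t).aestronglyMeasurable.mul hg)
    (Filter.Eventually.of_forall fun z s hs => ?_) (hgi.const_mul _)
    (Filter.Eventually.of_forall fun z s hs => ?_)).2
  · have hs' : r / 2 < s := hs
    have h1 : s ^ (-(3 / 2) : ℝ) ≤ (r / 2) ^ (-(3 / 2) : ℝ) :=
      Real.rpow_le_rpow_of_nonpos (by positivity) hs'.le (by norm_num)
    rw [Real.norm_eq_abs, abs_mul]
    calc _ ≤ A * (r ^ (1 / 2 - n : ℝ) * s ^ (-(3 / 2) : ℝ)) *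
          (1 + ‖z - x₀‖ / r) ^ (-(n + 1 / 2 : ℝ)) * |g z| := by
          gcongr
          exact h x₀ r hr x hx y hy s hs' z
      _ ≤ A * (r ^ (1 / 2 - n : ℝ) * (r / 2) ^ (-(3 / 2) : ℝ)) *
          (1 + ‖z - x₀‖ / r) ^ (-(n + 1 / 2 : ℝ)) * |g z| := by gcongr
      _ = _ := by ring
  · have hs0 : 0 < s := lt_trans (by positivity) (Set.mem_Ioi.1 hs)
    refine (((hasDerivAt_schwartzDil φ hs0 (x - z)).sub
      (hasDerivAt_schwartzDil φ hs0 (y - z))).mul_const (g z)).congr_deriv ?_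
    rw [schwartzDilSubDeriv, mul_sub]

theorem exists_abs_integral_schwartzDilSubDeriv_mul_le
    (φ : SchwartzMap (EuclideanSpace ℝ (Fin n)) ℝ) :
    ∃ A, 0 ≤ A ∧ ∀ (g : EuclideanSpace ℝ (Fin n) → ℝ) (x₀ : EuclideanSpace ℝ (Fin n)) (r : ℝ),
      0 < r → Integrable (fun z => |g z| * (1 + ‖z - x₀‖ / r) ^ (-(n + 1 / 2 : ℝ))) →
      ∀ x ∈ ball x₀ r, ∀ y ∈ ball x₀ r, ∀ t, r / 2 < t →
        |∫ z, schwartzDilSubDeriv φ x y t z * g z| ≤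
          A * (r ^ (1 / 2 - n : ℝ) * t ^ (-(3 / 2) : ℝ)) *
            ∫ z, |g z| * (1 + ‖z - x₀‖ / r) ^ (-(n + 1 / 2 : ℝ)) := by
  obtain ⟨A, hA, h⟩ := exists_abs_schwartzDilSubDeriv_le φ
  refine ⟨A, hA, fun g x₀ r hr hgi x hx y hy t ht => ?_⟩
  rw [← integral_const_mul, ← Real.norm_eq_abs]
  refine norm_integral_le_of_norm_le (hgi.const_mul _) (Filter.Eventually.of_forall fun z => ?_)
  rw [Real.norm_eq_abs, abs_mul]
  calc _ ≤ A * (r ^ (1 / 2 - n : ℝ) * t ^ (-(3 / 2) : ℝ)) *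
          (1 + ‖z - x₀‖ / r) ^ (-(n + 1 / 2 : ℝ)) * |g z| := by
          gcongr
          exact h x₀ r hr x hx y hy t ht z
    _ = _ := by ring

theorem integral_schwartzDil_sub_mul_sub_const
    (φ : SchwartzMap (EuclideanSpace ℝ (Fin n)) ℝ)
    {f : EuclideanSpace ℝ (Fin n) → ℝ} {x y : EuclideanSpace ℝ (Fin n)} {t a : ℝ} (ht : t ≠ 0)
    (hx : Integrable (fun z => schwartzDil φ t (x - z) * (f z - a)))
    (hy : Integrable (fun z => schwartzDil φ t (y - z) * (f z - a))) :
    ∫ z, (schwartzDil φ t (x - z) - schwartzDil φ t (y - z)) * (f z - a) =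
      (∫ z, schwartzDil φ t (x - z) * f z) - ∫ z, schwartzDil φ t (y - z) * f z := by
  have key : ∀ p, Integrable (fun z => schwartzDil φ t (p - z) * (f z - a)) →
      ∫ z, schwartzDil φ t (p - z) * f z =
        (∫ z, schwartzDil φ t (p - z) * (f z - a)) + (∫ z, schwartzDil φ t z) * a :=
    fun p hp => by
      rw [← integral_sub_left_eq_self (schwartzDil φ t) volume p, ← integral_mul_const,
        ← integral_add hp (((integrable_schwartzDil φ ht).comp_sub_left p).mul_const a)]
      congr 1
      ext z
      ring
  rw [key x hx, key y hy]
  simp only [sub_mul (schwartzDil φ t _)]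
  rw [integral_sub hx hy]
  ring

theorem integral_Ioi_rpow_neg_three_halves {r : ℝ} (hr : 0 < r) :
    ∫ t in Set.Ioi r, t ^ (-(3 / 2) : ℝ) = 2 * r ^ (-(1 / 2) : ℝ) := by
  rw [integral_Ioi_rpow_of_lt (by norm_num) hr]
  norm_num
  ring

theorem abs_sub_le_setIntegral_Ioi_abs_deriv {F : ℝ → ℝ} {r a b : ℝ} (hra : r ≤ a) (hab : a ≤ b)
    (hF : ∀ t, r ≤ t → DifferentiableAt ℝ F t)
    (hF' : IntegrableOn (deriv F) (Set.Ioi r)) :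
    |F b - F a| ≤ ∫ t in Set.Ioi r, |deriv F t| := by
  have hsub : Set.Ioc a b ⊆ Set.Ioi r := fun t ht => lt_of_le_of_lt hra ht.1
  rw [← intervalIntegral.integral_eq_sub_of_hasDerivAt (f' := deriv F)
    (fun t ht => (hF t (hra.trans (Set.uIcc_of_le hab ▸ ht).1)).hasDerivAt)
    ((intervalIntegrable_iff_integrableOn_Ioc_of_le hab).2 (hF'.mono_set hsub))]
  rw [intervalIntegral.integral_of_le hab]
  exact abs_integral_le_integral_abs.trans (setIntegral_mono_set hF'.abs
    (Filter.Eventually.of_forall fun _ => abs_nonneg _) hsub.eventuallyLE)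

end Main

theorem stmt18 (n : ℕ) (φ : SchwartzMap (EuclideanSpace ℝ (Fin n)) ℝ)
    (hφ : ∫ x, φ x = 1) :
    ∃ C > 0, ∀ (f : EuclideanSpace ℝ (Fin n) → ℝ) (M : ℝ),
      LocallyIntegrable f volume →
      (∀ (c : EuclideanSpace ℝ (Fin n)) (ρ : ℝ), 0 < ρ →
        ⨍ y in ball c ρ, |f y - ⨍ z in ball c ρ, f z| ≤ M) →
      ∀ (x₀ : EuclideanSpace ℝ (Fin n)) (r : ℝ), 0 < r →
      ∀ x ∈ ball x₀ r, ∀ y ∈ ball x₀ r, ∀ ε ε' : ℝ, r ≤ ε' → ε' < ε →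
        |((∫ z, schwartzDil φ ε (x - z) * f z) - ∫ z, schwartzDil φ ε' (x - z) * f z) -
          ((∫ z, schwartzDil φ ε (y - z) * f z) - ∫ z, schwartzDil φ ε' (y - z) * f z)|
          ≤ ∫ t in Set.Ioi r,
              |deriv (fun s : ℝ =>
                ∫ z, (schwartzDil φ s (x - z) - schwartzDil φ s (y - z)) *
                  (f z - ⨍ u in ball x₀ r, f u)) t| ∧
        (∫ t in Set.Ioi r,
            |deriv (fun s : ℝ =>
              ∫ z, (schwartzDil φ s (x - z) - schwartzDil φ s (y - z)) *
                (f z - ⨍ u in ball x₀ r, f u)) t|)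
          ≤ C * M := by
  obtain ⟨K, hK, hweight⟩ := exists_integral_abs_sub_average_mul_weight_le n
  obtain ⟨A, hA, hderiv⟩ := exists_abs_integral_schwartzDilSubDeriv_mul_le φ
  refine ⟨2 * (A * K) + 1, by positivity, ?_⟩
  intro f M hf hM x₀ r hr x hx y hy ε ε' hε' hε
  obtain ⟨hgi, hgM⟩ := hweight f M hf hM x₀ r hr
  have hg : AEStronglyMeasurable (fun z => f z - ⨍ u in ball x₀ r, f u) volume :=
    (hf.sub_const _).aestronglyMeasurable
  have hM0 : 0 ≤ M := by
    refine le_trans ?_ (hM x₀ r hr)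
    rw [setAverage_eq]
    positivity
  set F : ℝ → ℝ := fun s => ∫ z, (schwartzDil φ s (x - z) - schwartzDil φ s (y - z)) *
    (f z - ⨍ u in ball x₀ r, f u)
  have hFd : ∀ t, r ≤ t → HasDerivAt F
      (∫ z, schwartzDilSubDeriv φ x y t z * (f z - ⨍ u in ball x₀ r, f u)) t := fun t ht =>
    hasDerivAt_integral_schwartzDil_sub_mul φ hg hgi hr hx hy (by linarith)
  have hFb : ∀ t ∈ Set.Ioi r, |deriv F t| ≤
      A * K * M * r ^ (1 / 2 : ℝ) * t ^ (-(3 / 2) : ℝ) := fun t ht => by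
    have ht' : r < t := ht
    have ht0 : 0 < t := hr.trans ht'
    rw [(hFd t ht'.le).deriv]
    calc _ ≤ A * (r ^ (1 / 2 - n : ℝ) * t ^ (-(3 / 2) : ℝ)) * (K * M * r ^ n) :=
          (hderiv _ x₀ r hr hgi x hx y hy t (by linarith)).trans (by gcongr)
      _ = A * K * M * (r ^ (1 / 2 - n : ℝ) * r ^ n) * t ^ (-(3 / 2) : ℝ) := by ring
      _ = _ := by
          rw [← Real.rpow_natCast, ← Real.rpow_add hr, sub_add_cancel]
  have hbi : IntegrableOn (fun t => A * K * M * r ^ (1 / 2 : ℝ) * t ^ (-(3 / 2) : ℝ))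
      (Set.Ioi r) := (integrableOn_Ioi_rpow_of_lt (by norm_num) hr).const_mul _
  have hF' : IntegrableOn (deriv F) (Set.Ioi r) :=
    hbi.mono' (measurable_deriv F).aestronglyMeasurable
      ((ae_restrict_iff' measurableSet_Ioi).2 (Filter.Eventually.of_forall hFb))
  have hconv : ∀ s, r ≤ s → F s =
      (∫ z, schwartzDil φ s (x - z) * f z) - ∫ z, schwartzDil φ s (y - z) * f z := fun s hs =>
    integral_schwartzDil_sub_mul_sub_const φ (hr.trans_le hs).ne'
      (integrable_schwartzDil_sub_mul φ hg hgi hr hx (by linarith))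
      (integrable_schwartzDil_sub_mul φ hg hgi hr hy (by linarith))
  constructor
  · have h := abs_sub_le_setIntegral_Ioi_abs_deriv hε' hε.le
      (fun t ht => (hFd t ht).differentiableAt) hF'
    rw [hconv ε (hε'.trans hε.le), hconv ε' hε', sub_sub_sub_comm] at h
    exact h
  · calc ∫ t in Set.Ioi r, |deriv F t|
        ≤ ∫ t in Set.Ioi r, A * K * M * r ^ (1 / 2 : ℝ) * t ^ (-(3 / 2) : ℝ) :=
          setIntegral_mono_on hF'.abs hbi measurableSet_Ioi hFb
      _ = 2 * (A * K) * M * (r ^ (1 / 2 : ℝ) * r ^ (-(1 / 2) : ℝ)) := by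
          rw [integral_const_mul, integral_Ioi_rpow_neg_three_halves hr]
          ring
      _ = 2 * (A * K) * M := by
          rw [← Real.rpow_add hr, add_neg_cancel, Real.rpow_zero, mul_one]
      _ ≤ (2 * (A * K) + 1) * M := by linarith
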